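/- arXiv:1605.02841 — 2 statements merged into one kernel-verified Lean document; each statement's English description precedes it below -/
import Mathlib

section
/- Let k ⊆ E ⊆ L ⊆ k̄ be fields with [L : E] = ℓ a prime number different from p = char k. Then L/E is not a cyclotomic coradical extension. -/
open Polynomial IntermediateField

noncomputable section

variable (Fq : Type) [Field Fq] [Fintype Fq]

/-- A fixed algebraic closure of the rational function field `k = Fq(T)`. -/
abbrev Kbar := AlgebraicClosure (RatFunc Fq)

/-- The Carlitz action of `T`: the `Fq`-linear map `u ↦ T•u + u^q`. -/
def carlitzT : Module.End Fq (Kbar Fq) where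
  toFun u := algebraMap (RatFunc Fq) (Kbar Fq) RatFunc.X * u + u ^ Fintype.card Fq
  map_add' u v := by
    obtain ⟨n, hp, hcard⟩ := FiniteField.card Fq (ringChar Fq)
    haveI : Fact (ringChar Fq).Prime := ⟨hp⟩
    haveI : CharP (Kbar Fq) (ringChar Fq) :=
      charP_of_injective_algebraMap (algebraMap Fq (Kbar Fq)).injective _
    show algebraMap (RatFunc Fq) (Kbar Fq) RatFunc.X * (u + v) + (u + v) ^ Fintype.card Fq =
      (algebraMap (RatFunc Fq) (Kbar Fq) RatFunc.X * u + u ^ Fintype.card Fq) +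
        (algebraMap (RatFunc Fq) (Kbar Fq) RatFunc.X * v + v ^ Fintype.card Fq)
    rw [hcard, add_pow_char_pow]
    ring
  map_smul' c u := by
    simp only [RingHom.id_apply, smul_add, mul_smul_comm, _root_.smul_pow, FiniteField.pow_card]

/-- The Carlitz module: the `Fq`-algebra morphism `Fq[T] → End_{Fq}(k̄)`
determined by `T ↦ (u ↦ T·u + u^q)`. -/
def carlitzHom : Polynomial Fq →ₐ[Fq] Module.End Fq (Kbar Fq) :=
  aeval (carlitzT Fq)

/-- The Carlitz action `C_a(u)`. -/
def carlitz (a : Polynomial Fq) (u : Kbar Fq) : Kbar Fq :=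
  carlitzHom Fq a u

/-- `Λ_a = {u ∈ k̄ : C_a(u) = 0}`. -/
def Lambda (a : Polynomial Fq) : Set (Kbar Fq) := {u | carlitz Fq a u = 0}

/-- The Carlitz torsion `μ(L)` of an intermediate field `L`. -/
def carlitzTorsion (L : IntermediateField (RatFunc Fq) (Kbar Fq)) : Set (Kbar Fq) :=
  {u | u ∈ L ∧ ∃ a : Polynomial Fq, a ≠ 0 ∧ carlitz Fq a u = 0}

/-- `DrinT(L/K) = {u ∈ L : C_m(u) ∈ K for some nonzero m}`. -/
def DrinT (K L : IntermediateField (RatFunc Fq) (Kbar Fq)) : Set (Kbar Fq) :=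
  {u | u ∈ L ∧ ∃ m : Polynomial Fq, m ≠ 0 ∧ carlitz Fq m u ∈ K}

/-- `L/K` is radical: `L = K(X)` for some `X ⊆ DrinT(L/K)`. -/
def IsRadicalC (K L : IntermediateField (RatFunc Fq) (Kbar Fq)) : Prop :=
  ∃ X ⊆ DrinT Fq K L, L = adjoin (RatFunc Fq) ((K : Set (Kbar Fq)) ∪ X)

/-- `L/K` is pure: every root in `L` of some `C_m`, `m` irreducible, lies in `K`. -/
def IsPureC (K L : IntermediateField (RatFunc Fq) (Kbar Fq)) : Prop :=
  ∀ m : Polynomial Fq, Irreducible m → ∀ u ∈ L, carlitz Fq m u = 0 → u ∈ K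

/-- `L/K` is separable: every element of `L` is separable over `K`. -/
def IsSeparableC (K L : IntermediateField (RatFunc Fq) (Kbar Fq)) : Prop :=
  ∀ u ∈ L, IsSeparable K u

/-- `L/K` is cyclotomic coradical: radical, separable and pure. -/
def IsCycloCoradicalC (K L : IntermediateField (RatFunc Fq) (Kbar Fq)) : Prop :=
  IsRadicalC Fq K L ∧ IsSeparableC Fq K L ∧ IsPureC Fq K L


theorem carlitz_mul (a b : Polynomial Fq) (u : Kbar Fq) :
    carlitz Fq (a * b) u = carlitz Fq a (carlitz Fq b u) := by
  simp [carlitz]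

theorem carlitz_add (a b : Polynomial Fq) (u : Kbar Fq) :
    carlitz Fq (a + b) u = carlitz Fq a u + carlitz Fq b u := by
  simp [carlitz]

theorem carlitz_one (u : Kbar Fq) : carlitz Fq 1 u = u := by
  simp [carlitz]

theorem carlitz_apply_zero (a : Polynomial Fq) : carlitz Fq a 0 = 0 :=
  map_zero (carlitzHom Fq a)

theorem carlitz_apply_sub (a : Polynomial Fq) (u v : Kbar Fq) :
    carlitz Fq a (u - v) = carlitz Fq a u - carlitz Fq a v :=
  map_sub (carlitzHom Fq a) u v

theorem carlitz_C (c : Fq) (u : Kbar Fq) : carlitz Fq (C c) u = algebraMap Fq _ c * u := by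
  simp [carlitz, carlitzHom, Algebra.smul_def]

theorem carlitz_X (u : Kbar Fq) : carlitz Fq X u =
    algebraMap (RatFunc Fq) (Kbar Fq) RatFunc.X * u + u ^ Fintype.card Fq := by
  simp [carlitz, carlitzHom, carlitzT]

/-- `C_a` is evaluation of a polynomial of degree `q ^ deg a` over `k`. -/
theorem exists_polynomial_eval_eq_carlitz (n : ℕ) : ∀ a : Polynomial Fq, a ≠ 0 →
    a.natDegree = n → ∃ f : Polynomial (RatFunc Fq), f.natDegree = Fintype.card Fq ^ n ∧
      ∀ u, aeval u f = carlitz Fq a u := by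
  induction n with
  | zero =>
    intro a ha hn
    obtain ⟨c, rfl⟩ := natDegree_eq_zero.mp hn
    have hc : c ≠ 0 := by rintro rfl; simp at ha
    refine ⟨C (algebraMap Fq _ c) * X, ?_, fun u => ?_⟩
    · rw [natDegree_C_mul_X _ (by simpa using hc), pow_zero]
    · rw [carlitz_C]
      rw [map_mul, aeval_C, aeval_X, ← IsScalarTower.algebraMap_apply]
  | succ n ih =>
    intro a ha hn
    have hd : a.divX.natDegree = n := by rw [natDegree_divX_eq_natDegree_tsub_one]; omega
    have hd0 : a.divX ≠ 0 := by
      intro h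
      rw [divX_eq_zero_iff] at h
      rw [h, natDegree_C] at hn
      omega
    obtain ⟨g, hg, hgu⟩ := ih _ hd0 hd
    have hq : 1 < Fintype.card Fq := Fintype.one_lt_card
    have hpos : 0 < Fintype.card Fq ^ n := by positivity
    have hlt : Fintype.card Fq ^ n < Fintype.card Fq ^ (n + 1) := Nat.pow_lt_pow_succ hq
    refine ⟨g ^ Fintype.card Fq + (C RatFunc.X * g + C (algebraMap Fq _ (a.coeff 0)) * X),
      ?_, fun u => ?_⟩
    · have hpow : (g ^ Fintype.card Fq).natDegree = Fintype.card Fq ^ (n + 1) := by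
        rw [natDegree_pow, hg, pow_succ, mul_comm]
      rw [natDegree_add_eq_left_of_natDegree_lt, hpow]
      rw [hpow]
      refine lt_of_le_of_lt (natDegree_add_le_of_degree_le
        ((natDegree_C_mul_le _ _).trans hg.le) ?_) hlt
      exact ((natDegree_C_mul_le _ _).trans natDegree_X_le).trans hpos
    · conv_rhs => rw [← X_mul_divX_add a]
      rw [carlitz_add, carlitz_mul, carlitz_X, carlitz_C, ← hgu]
      simp only [map_add, map_mul, map_pow, aeval_C, aeval_X, ← IsScalarTower.algebraMap_apply]
      ring

variable {Fq}

theorem exists_aeval_eq_carlitz (a : Polynomial Fq) :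
    ∃ f : Polynomial (RatFunc Fq), ∀ u, aeval u f = carlitz Fq a u := by
  rcases eq_or_ne a 0 with rfl | ha
  · exact ⟨0, fun u => by simp [carlitz]⟩
  · obtain ⟨f, -, hf⟩ := exists_polynomial_eval_eq_carlitz Fq _ a ha rfl
    exact ⟨f, hf⟩

theorem carlitz_mem (E : IntermediateField (RatFunc Fq) (Kbar Fq)) (a : Polynomial Fq)
    {u : Kbar Fq} (hu : u ∈ E) : carlitz Fq a u ∈ E := by
  obtain ⟨f, hf⟩ := exists_aeval_eq_carlitz a
  rw [← hf, show aeval u f = E.val (aeval (⟨u, hu⟩ : E) f) from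
    aeval_algHom_apply E.val (⟨u, hu⟩ : E) f]
  exact SetLike.coe_mem _

theorem carlitz_eq_of_isConjRoot (E : IntermediateField (RatFunc Fq) (Kbar Fq))
    (a : Polynomial Fq) {u v : Kbar Fq} (hu : carlitz Fq a u ∈ E) (h : IsConjRoot E u v) :
    carlitz Fq a v = carlitz Fq a u := by
  obtain ⟨σ, rfl⟩ := isConjRoot_iff_exists_algEquiv.mp h.symm
  obtain ⟨f, hf⟩ := exists_aeval_eq_carlitz a
  have h1 : aeval (σ u) f = σ (aeval u f) :=
    aeval_algHom_apply (σ.toAlgHom.restrictScalars (RatFunc Fq)) u f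
  rw [← hf, h1, hf]
  exact σ.commutes ⟨_, hu⟩

/-- The torsion points of an irreducible form a cyclic `Fq[T]`-module. -/
theorem exists_eq_carlitz_of_irreducible {P : Polynomial Fq} (hP : Irreducible P)
    {w v : Kbar Fq} (hw0 : w ≠ 0) (hw : carlitz Fq P w = 0) (hv : carlitz Fq P v = 0) :
    ∃ a, v = carlitz Fq a w := by
  classical
  obtain ⟨f, hf, hfu⟩ := exists_polynomial_eval_eq_carlitz Fq _ P hP.ne_zero rfl
  have hf0 : f ≠ 0 := by
    rintro rfl
    have : 0 < Fintype.card Fq ^ P.natDegree := by positivity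
    rw [natDegree_zero] at hf
    omega
  have hmem : ∀ x, x ∈ f.rootSet (Kbar Fq) ↔ carlitz Fq P x = 0 := fun x => by
    rw [mem_rootSet, hfu]; simp [hf0]
  let φ : degreeLT Fq P.natDegree → f.rootSet (Kbar Fq) := fun a =>
    ⟨carlitz Fq a.1 w, by
      rw [hmem, ← carlitz_mul, mul_comm, carlitz_mul, hw, carlitz_apply_zero]⟩
  have hinj : Function.Injective φ := by
    intro a b hab
    have hab' : carlitz Fq (a.1 - b.1) w = 0 := by
      have := Subtype.ext_iff.mp hab
      simpa [carlitz, φ, sub_eq_zero] using this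
    by_contra hne
    have hsub : a.1 - b.1 ≠ 0 := fun h => hne (Subtype.ext (sub_eq_zero.mp h))
    have hdeg : (a.1 - b.1).degree < P.degree := by
      rw [degree_eq_natDegree hP.ne_zero]
      exact mem_degreeLT.mp (a - b).2
    have hcop : IsCoprime P (a.1 - b.1) :=
      hP.coprime_iff_not_dvd.mpr fun h => absurd (degree_le_of_dvd h hsub) hdeg.not_ge
    obtain ⟨x, y, hxy⟩ := hcop
    apply hw0
    rw [← carlitz_one Fq w, ← hxy, carlitz_add, carlitz_mul, carlitz_mul, hw, hab',
      carlitz_apply_zero, carlitz_apply_zero, add_zero]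
  have e := (degreeLTEquiv Fq P.natDegree).toEquiv
  have : Fintype (degreeLT Fq P.natDegree) := Fintype.ofEquiv _ e.symm
  have hcard : Fintype.card (degreeLT Fq P.natDegree) = Fintype.card Fq ^ P.natDegree := by
    rw [Fintype.card_congr e]; simp
  have hle : Fintype.card (f.rootSet (Kbar Fq)) ≤ Fintype.card (degreeLT Fq P.natDegree) := by
    rw [hcard, ← hf, ← Set.toFinset_card]
    simp only [rootSet_def, Finset.toFinset_coe]
    exact (Multiset.toFinset_card_le _).trans
      ((card_roots' _).trans natDegree_map_le)
  have hbij := (Fintype.bijective_iff_injective_and_card φ).mpr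
    ⟨hinj, le_antisymm (Fintype.card_le_of_injective φ hinj) hle⟩
  obtain ⟨a, ha⟩ := hbij.2 ⟨v, (hmem v).mpr hv⟩
  exact ⟨a.1, (Subtype.ext_iff.mp ha).symm⟩

/-- Sum of the differences between the conjugates of `u` over `E` and `u` itself: if all the
differences lie in an additive subgroup, then so does `s - n u` for some `s ∈ E`, where `n` is the
degree of `u`. -/
theorem exists_sub_natDegree_mul_mem {k K : Type*} [Field k] [Field K] [Algebra k K]
    [IsAlgClosed K] [Algebra.IsAlgebraic k K]
    (E : IntermediateField k K) (S : AddSubgroup K) (u : K)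
    (h : ∀ v, IsConjRoot E u v → v - u ∈ S) :
    ∃ s ∈ E, s - (minpoly E u).natDegree * u ∈ S := by
  have hint : IsIntegral E u := (Algebra.IsAlgebraic.tower_top (K := k) E).isIntegral.isIntegral u
  set f := (minpoly E u).map (algebraMap E K) with hf
  have hsp : f.Splits := IsAlgClosed.splits f
  refine ⟨f.roots.sum, ?_, ?_⟩
  · have := hsp.nextCoeff_eq_neg_sum_roots_of_monic ((minpoly.monic hint).map _)
    rw [hf, nextCoeff_map (algebraMap E K).injective] at this
    rw [← neg_neg (Multiset.sum _), ← this]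
    exact E.neg_mem (SetLike.coe_mem _)
  · have hcard : f.roots.card = (minpoly E u).natDegree := by
      rw [← hsp.natDegree_eq_card_roots, hf, natDegree_map]
    have hsum : f.roots.sum - (minpoly E u).natDegree * u =
        (f.roots.map fun v => v - u).sum := by
      rw [Multiset.sum_map_sub, Multiset.map_id', Multiset.map_const', Multiset.sum_replicate,
        hcard, nsmul_eq_mul]
    rw [hsum]
    refine S.multiset_sum_mem _ fun x hx => ?_
    obtain ⟨v, hv, rfl⟩ := Multiset.mem_map.mp hx
    refine h v ((isConjRoot_iff_mem_minpoly_aroots hint).mpr hv)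

theorem mem_of_natDegree_mul_mem {k K : Type*} [Field k] [Field K] [Algebra k K]
    (E : IntermediateField k K) {n : ℕ} (hn : (n : K) ≠ 0) {u : K} (h : n * u ∈ E) : u ∈ E := by
  have := E.mul_mem (E.inv_mem (_root_.natCast_mem E n)) h
  rwa [inv_mul_cancel_left₀ hn] at this

/-- In a pure extension all of whose elements have degree prime to `p`, every torsion point
of the top field is in the bottom field. -/
theorem mem_of_carlitz_eq_zero {E L : IntermediateField (RatFunc Fq) (Kbar Fq)}
    (hpure : IsPureC Fq E L)
    (hdeg : ∀ u ∈ L, ((minpoly E u).natDegree : Kbar Fq) ≠ 0) (m : Polynomial Fq) :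
    m ≠ 0 → ∀ u ∈ L, carlitz Fq m u = 0 → u ∈ E := by
  induction m using UniqueFactorizationMonoid.induction_on_coprime with
  | h0 => exact fun h => absurd rfl h
  | h1 hx =>
    intro _ u _ h
    obtain ⟨y, hy⟩ := hx.exists_left_inv
    rw [← carlitz_one Fq u, ← hy, carlitz_mul, h, carlitz_apply_zero]
    exact E.zero_mem
  | @hpr P n hP =>
    induction n with
    | zero =>
      intro _ u _ h
      rw [pow_zero, carlitz_one] at h
      exact h ▸ E.zero_mem
    | succ n ih =>
      intro _ u hu h
      have hPE : carlitz Fq P u ∈ E :=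
        ih (pow_ne_zero n hP.ne_zero) _ (carlitz_mem L P hu) (by rw [← carlitz_mul, ← pow_succ, h])
      have hw : carlitz Fq P (carlitz Fq (P ^ n) u) = 0 := by
        rw [← carlitz_mul, ← pow_succ', h]
      by_cases hw0 : carlitz Fq (P ^ n) u = 0
      · exact ih (pow_ne_zero n hP.ne_zero) u hu hw0
      have hwE := hpure P hP.irreducible _ (carlitz_mem L (P ^ n) hu) hw
      obtain ⟨s, hs, hsu⟩ := exists_sub_natDegree_mul_mem E E.toSubfield.toAddSubgroup u
        fun v hv => by
          obtain ⟨a, ha⟩ := exists_eq_carlitz_of_irreducible hP.irreducible hw0 hw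
            (v := v - u) (by
              rw [carlitz_apply_sub, carlitz_eq_of_isConjRoot E P hPE hv, sub_self])
          rw [ha]
          exact carlitz_mem E a hwE
      refine mem_of_natDegree_mul_mem E (hdeg u hu) ?_
      have := E.sub_mem hs hsu
      rwa [sub_sub_cancel] at this
  | @hcp a b hab iha ihb =>
    intro h0 u hu h
    obtain ⟨x, y, hxy⟩ := hab.isCoprime
    rw [← carlitz_one Fq u, ← hxy, carlitz_add]
    refine E.add_mem ?_ ?_
    · refine ihb (right_ne_zero_of_mul h0) _ (carlitz_mem L _ hu) ?_
      rw [← carlitz_mul, show b * (x * a) = x * (a * b) by ring, carlitz_mul, h,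
        carlitz_apply_zero]
    · refine iha (left_ne_zero_of_mul h0) _ (carlitz_mem L _ hu) ?_
      rw [← carlitz_mul, show a * (y * b) = y * (a * b) by ring, carlitz_mul, h,
        carlitz_apply_zero]

/-- Under the same hypotheses, `DrinT(L/E) = E`. -/
theorem mem_of_mem_DrinT {E L : IntermediateField (RatFunc Fq) (Kbar Fq)} (hEL : E ≤ L)
    (hpure : IsPureC Fq E L)
    (hdeg : ∀ u ∈ L, ((minpoly E u).natDegree : Kbar Fq) ≠ 0) {u : Kbar Fq}
    (h : u ∈ DrinT Fq E L) : u ∈ E := by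
  obtain ⟨hu, m, hm, hmu⟩ := h
  obtain ⟨s, hs, hsu⟩ := exists_sub_natDegree_mul_mem E
    (LinearMap.ker (carlitzHom Fq m)).toAddSubgroup u fun v hv => by
      change carlitz Fq m (v - u) = 0
      rw [carlitz_apply_sub, carlitz_eq_of_isConjRoot E m hmu hv, sub_self]
  refine mem_of_natDegree_mul_mem E (hdeg u hu) ?_
  have hmem := mem_of_carlitz_eq_zero hpure hdeg m hm _
    (L.sub_mem (hEL hs) (L.mul_mem (_root_.natCast_mem L _) hu)) hsu
  have := E.sub_mem hs hmem
  rwa [sub_sub_cancel] at this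

variable (Fq)

/-- If `k ⊆ E ⊆ L ⊆ k̄` with `[L : E] = ℓ` a prime different from
`p = char k`, then `L/E` is not cyclotomic coradical. -/
theorem not_isCycloCoradical_of_prime_degree (p : ℕ) [Fact p.Prime] [CharP Fq p]
    (E L : IntermediateField (RatFunc Fq) (Kbar Fq)) (hEL : E ≤ L)
    (ℓ : ℕ) (hℓ : ℓ.Prime) (hℓp : ℓ ≠ p)
    (hdeg : Module.finrank E (extendScalars hEL) = ℓ) :
    ¬ IsCycloCoradicalC Fq E L := by
  rintro ⟨⟨X, hX, hLX⟩, -, hpure⟩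
  have : CharP (Kbar Fq) p :=
    charP_of_injective_algebraMap (algebraMap Fq (Kbar Fq)).injective p
  have hfin : FiniteDimensional E (extendScalars hEL) :=
    Module.finite_of_finrank_pos (hdeg ▸ hℓ.pos)
  have hdvd : ∀ u ∈ L, ((minpoly E u).natDegree : Kbar Fq) ≠ 0 := by
    intro u hu h0
    have h1 : (minpoly E u).natDegree ∣ ℓ := by
      rw [← hdeg, show minpoly E u = minpoly E (⟨u, hu⟩ : extendScalars hEL) from
        minpoly.algHom_eq (extendScalars hEL).val (extendScalars hEL).val.injective ⟨u, hu⟩]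
      exact minpoly.degree_dvd (IsIntegral.of_finite E _)
    have h2 := ((CharP.cast_eq_zero_iff (Kbar Fq) p _).mp h0).trans h1
    exact hℓp ((Nat.prime_dvd_prime_iff_eq Fact.out hℓ).mp h2).symm
  have hLE : L ≤ E := by
    rw [hLX, adjoin_le_iff]
    exact Set.union_subset le_rfl fun u hu => mem_of_mem_DrinT hEL hpure hdvd (hX hu)
  obtain rfl := le_antisymm hEL hLE
  rw [extendScalars_self, IntermediateField.finrank_bot] at hdeg
  exact hℓ.one_lt.ne hdeg

end
end

section
/- Let k ⊆ E ⊆ L ⊆ k̄ with L/E pure, L = E(α) for some α ∈ L, and suppose there exists an irreducible d ∈ F_q[T] with C_d(α) ∈ E. Then L/E is a cyclotomic coradical extension and [L : E] = p^s for some s ∈ ℕ. Moreover (with λ_d a generator of Λ_d), E(α) ∩ E(λ_d) = E, [L : E] = [L(λ_d) : E(λ_d)], and the minimal polynomial of α over E equals its minimal polynomial over E(λ_d). -/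
open Polynomial IntermediateField

noncomputable section

variable (Fq : Type) [Field Fq] [Fintype Fq]

set_option synthInstance.maxHeartbeats 1000000

namespace IntermediateField

variable {k Ω : Type*} [Field k] [Field Ω] [Algebra k Ω]

/-- Conjugate elements over an intermediate field `M` of a normal extension are related by an
automorphism fixing `M`. -/
theorem isConjRoot_iff_exists_mem_fixingSubgroup [Normal k Ω] (M : IntermediateField k Ω)
    {x y : Ω} :
    IsConjRoot M x y ↔ ∃ σ ∈ M.fixingSubgroup, σ x = y := by
  constructor
  · intro h
    obtain ⟨σ, rfl⟩ := isConjRoot_iff_exists_algEquiv.mp h.symm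
    refine ⟨σ.restrictScalars k, ?_, rfl⟩
    rw [mem_fixingSubgroup_iff]
    exact fun z hz => σ.commutes ⟨z, hz⟩
  · rintro ⟨σ, hσ, rfl⟩
    exact (isConjRoot_of_algEquiv x (M.fixingSubgroupEquiv ⟨σ, hσ⟩))

theorem mem_of_forall_mem_fixingSubgroup [Normal k Ω] (M : IntermediateField k Ω) {x : Ω}
    (hx : IsSeparable M x) (h : ∀ σ ∈ M.fixingSubgroup, σ x = x) : x ∈ M := by
  by_contra hxM
  have hxM' : x ∉ (⊥ : Subalgebra M Ω) := by
    rintro ⟨⟨z, hz⟩, rfl⟩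
    exact hxM hz
  obtain ⟨y, hne, hy⟩ := (notMem_iff_exists_ne_and_isConjRoot hx
    (Normal.splits inferInstance x)).mp hxM'
  obtain ⟨σ, hσ, rfl⟩ := M.isConjRoot_iff_exists_mem_fixingSubgroup.mp hy
  exact hne (h σ hσ).symm

theorem natDegree_minpoly_eq_card_orbit [Normal k Ω] (M : IntermediateField k Ω) {x : Ω}
    (hx : IsSeparable M x) :
    (minpoly M x).natDegree = Nat.card {y : Ω | ∃ σ ∈ M.fixingSubgroup, σ x = y} := by
  rw [← card_rootSet_eq_natDegree (K := Ω) hx (Normal.splits inferInstance x),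
    ← Nat.card_eq_fintype_card]
  congr! 3
  ext y
  rw [Set.mem_ofPred_eq, ← isConjRoot_iff_exists_mem_fixingSubgroup,
    isConjRoot_iff_mem_minpoly_rootSet hx.isIntegral]

theorem minpoly_map_inclusion_eq [Normal k Ω] {M N : IntermediateField k Ω} (hMN : M ≤ N) {x : Ω}
    (hx : IsSeparable M x) (hxN : IsSeparable N x)
    (h : ∀ τ ∈ M.fixingSubgroup, ∃ σ ∈ N.fixingSubgroup, σ x = τ x) :
    (minpoly M x).map (inclusion hMN).toRingHom = minpoly N x := by
  have hdeg : (minpoly M x).natDegree = (minpoly N x).natDegree := by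
    rw [natDegree_minpoly_eq_card_orbit M hx, natDegree_minpoly_eq_card_orbit N hxN]
    congr! 3
    ext y
    constructor
    · rintro ⟨τ, hτ, rfl⟩
      exact h τ hτ
    · rintro ⟨σ, hσ, rfl⟩
      exact ⟨σ, fixingSubgroup_le hMN hσ, rfl⟩
  refine eq_of_monic_of_dvd_of_natDegree_le (minpoly.monic hxN.isIntegral)
    ((minpoly.monic hx.isIntegral).map _) (minpoly.dvd _ _ ?_) ?_
  · rw [aeval_def, eval₂_map]
    exact minpoly.aeval M x
  · rw [natDegree_map, hdeg]

theorem extendScalars_eq_adjoin_simple {M L : IntermediateField k Ω} (hML : M ≤ L) {x : Ω}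
    (hL : L = adjoin k ((M : Set Ω) ∪ {x})) : extendScalars hML = adjoin M {x} := by
  apply restrictScalars_injective k
  rw [restrictScalars_adjoin, extendScalars_restrictScalars, hL]

theorem isSeparable_of_mem_adjoin {M L : IntermediateField k Ω} (hML : M ≤ L) {x : Ω}
    (hL : L = adjoin k ((M : Set Ω) ∪ {x})) (hx : IsSeparable M x) {u : Ω} (hu : u ∈ L) :
    IsSeparable M u := by
  have hle : adjoin M {x} ≤ separableClosure M Ω := by
    rw [adjoin_le_iff, Set.singleton_subset_iff]
    exact mem_separableClosure_iff.mpr hx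
  rw [← extendScalars_eq_adjoin_simple hML hL] at hle
  exact mem_separableClosure_iff.mp (hle hu)

theorem finrank_extendScalars_eq_natDegree {M L : IntermediateField k Ω} (hML : M ≤ L) {x : Ω}
    (hL : L = adjoin k ((M : Set Ω) ∪ {x})) (hx : IsIntegral M x) :
    Module.finrank M (extendScalars hML) = (minpoly M x).natDegree := by
  rw [extendScalars_eq_adjoin_simple hML hL, adjoin.finrank hx]

theorem mem_fixingSubgroup_adjoin_union_singleton {M : IntermediateField k Ω} {x : Ω}
    {σ : Gal(Ω/k)} :
    σ ∈ (adjoin k ((M : Set Ω) ∪ {x})).fixingSubgroup ↔ σ ∈ M.fixingSubgroup ∧ σ x = x := by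
  constructor
  · intro h
    rw [mem_fixingSubgroup_iff] at h
    exact ⟨(mem_fixingSubgroup_iff _ _).mpr fun z hz => h z (subset_adjoin _ _ (Or.inl hz)),
      h x (subset_adjoin _ _ (Or.inr rfl))⟩
  · rintro ⟨h, hx⟩
    rw [← Subgroup.zpowers_le, ← le_iff_le, adjoin_le_iff]
    have key : ∀ z, σ z = z → z ∈ fixedField (Subgroup.zpowers σ) := by
      rintro z hz ⟨τ, hτ⟩
      have : Subgroup.zpowers σ ≤ MulAction.stabilizer Gal(Ω/k) z := by
        rw [Subgroup.zpowers_le]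
        exact hz
      exact this hτ
    rintro z (hz | rfl)
    · exact key z ((mem_fixingSubgroup_iff _ _).mp h z hz)
    · exact key z hx

/-- The displacements `σ x - x` of `x` under the automorphisms fixing `F`, when these automorphisms
also fix the displacements. -/
def displacement (F : IntermediateField k Ω) (x : Ω)
    (h : ∀ σ ∈ F.fixingSubgroup, ∀ τ ∈ F.fixingSubgroup, σ (τ x - x) = τ x - x) :
    AddSubgroup Ω where
  carrier := {v | ∃ σ ∈ F.fixingSubgroup, σ x - x = v}
  zero_mem' := ⟨1, one_mem _, sub_self x⟩
  add_mem' := by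
    rintro _ _ ⟨σ, hσ, rfl⟩ ⟨τ, hτ, rfl⟩
    refine ⟨σ * τ, mul_mem hσ hτ, ?_⟩
    have := h σ hσ τ hτ
    rw [map_sub] at this
    rw [AlgEquiv.mul_apply]
    linear_combination this
  neg_mem' := by
    rintro _ ⟨σ, hσ, rfl⟩
    refine ⟨σ⁻¹, inv_mem hσ, ?_⟩
    have := h σ⁻¹ (inv_mem hσ) σ hσ
    rw [map_sub, ← AlgEquiv.mul_apply, inv_mul_cancel, AlgEquiv.one_apply] at this
    linear_combination -this

theorem mem_displacement {F : IntermediateField k Ω} {x : Ω}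
    {h : ∀ σ ∈ F.fixingSubgroup, ∀ τ ∈ F.fixingSubgroup, σ (τ x - x) = τ x - x} {v : Ω} :
    v ∈ displacement F x h ↔ ∃ σ ∈ F.fixingSubgroup, σ x - x = v := Iff.rfl

theorem card_orbit_eq_card_displacement {F : IntermediateField k Ω} {x : Ω}
    (h : ∀ σ ∈ F.fixingSubgroup, ∀ τ ∈ F.fixingSubgroup, σ (τ x - x) = τ x - x) :
    Nat.card {y : Ω | ∃ σ ∈ F.fixingSubgroup, σ x = y} = Nat.card (displacement F x h) :=
  Nat.card_congr ((Equiv.subRight x).subtypeEquiv fun y => by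
    rw [mem_displacement]
    exact exists_congr fun σ => and_congr_right fun _ => (sub_left_inj (a := x)).symm)

end IntermediateField

theorem AddSubgroup.exists_card_eq_prime_pow {R : Type*} [Ring R] (p : ℕ) [Fact p.Prime] [CharP R p]
    (V : AddSubgroup R) (hV : (V : Set R).Finite) : ∃ s : ℕ, Nat.card V = p ^ s := by
  have : Finite V := hV
  let _ : Module (ZMod p) V := AddCommGroup.zmodModule fun v => by
    ext
    simp
  exact ⟨Module.finrank (ZMod p) V, (FiniteField.pow_finrank_eq_natCard p V).symm⟩

namespace Carlitz

/-- The polynomial over `k = Fq(T)` inducing `C_{T^i}`. -/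
def powPoly : ℕ → (RatFunc Fq)[X]
  | 0 => X
  | i + 1 => C RatFunc.X * powPoly i + powPoly i ^ Fintype.card Fq

/-- The polynomial over `k = Fq(T)` inducing `C_a`. -/
def poly (a : Fq[X]) : (RatFunc Fq)[X] :=
  a.sum fun i c => C (algebraMap Fq (RatFunc Fq) c) * powPoly Fq i

variable {Fq}

theorem carlitz_mul (a b : Fq[X]) (u : Kbar Fq) :
    carlitz Fq (a * b) u = carlitz Fq a (carlitz Fq b u) := by
  simp [carlitz]

theorem carlitz_comm (a b : Fq[X]) (u : Kbar Fq) :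
    carlitz Fq a (carlitz Fq b u) = carlitz Fq b (carlitz Fq a u) := by
  rw [← carlitz_mul, mul_comm, carlitz_mul]

theorem carlitz_one (u : Kbar Fq) : carlitz Fq 1 u = u := by
  simp [carlitz]

theorem carlitz_add_left (a b : Fq[X]) (u : Kbar Fq) :
    carlitz Fq (a + b) u = carlitz Fq a u + carlitz Fq b u := by
  simp [carlitz]

theorem carlitz_sub_left (a b : Fq[X]) (u : Kbar Fq) :
    carlitz Fq (a - b) u = carlitz Fq a u - carlitz Fq b u := by
  simp [carlitz]

theorem carlitz_sub (a : Fq[X]) (u v : Kbar Fq) :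
    carlitz Fq a (u - v) = carlitz Fq a u - carlitz Fq a v := map_sub _ _ _

theorem carlitz_zero (a : Fq[X]) : carlitz Fq a 0 = 0 := map_zero _

theorem aeval_powPoly (i : ℕ) (u : Kbar Fq) :
    aeval u (powPoly Fq i) = (carlitzT Fq ^ i) u := by
  induction i with
  | zero => simp [powPoly]
  | succ i ih =>
    rw [powPoly, pow_succ', Module.End.mul_apply, ← ih]
    simp [carlitzT]

theorem aeval_poly (a : Fq[X]) (u : Kbar Fq) : aeval u (poly Fq a) = carlitz Fq a u := by
  rw [carlitz, carlitzHom, aeval_eq_sum_range (p := a), poly, sum_over_range _ (by simp), map_sum,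
    LinearMap.sum_apply]
  refine Finset.sum_congr rfl fun i _ => ?_
  rw [map_mul, aeval_C, aeval_powPoly, LinearMap.smul_apply, Algebra.smul_def,
    ← IsScalarTower.algebraMap_apply]

theorem derivative_powPoly (i : ℕ) :
    derivative (powPoly Fq i) = C (RatFunc.X ^ i) := by
  induction i with
  | zero => simp [powPoly]
  | succ i ih =>
    have hq : ((Fintype.card Fq : ℕ) : (RatFunc Fq)[X]) = 0 := by
      rw [← map_natCast (algebraMap Fq (RatFunc Fq)[X]), FiniteField.cast_card_eq_zero, map_zero]
    simp [powPoly, derivative_pow, ih, pow_succ', hq]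

theorem derivative_poly (a : Fq[X]) :
    derivative (poly Fq a) = C (algebraMap Fq[X] (RatFunc Fq) a) := by
  rw [poly, sum_over_range _ (by simp), derivative_sum]
  conv_rhs => rw [a.as_sum_range_C_mul_X_pow, map_sum, map_sum]
  refine Finset.sum_congr rfl fun i _ => ?_
  simp [derivative_powPoly, RatFunc.algebraMap_C, RatFunc.algebraMap_X]

theorem natDegree_powPoly_le (i : ℕ) : (powPoly Fq i).natDegree ≤ Fintype.card Fq ^ i := by
  have hq : 1 ≤ Fintype.card Fq := Fintype.card_pos
  induction i with
  | zero => simp [powPoly]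
  | succ i ih =>
    refine (natDegree_add_le _ _).trans (max_le ?_ ?_)
    · exact (natDegree_C_mul_le _ _).trans (ih.trans (Nat.pow_le_pow_right hq (Nat.le_succ i)))
    · refine natDegree_pow_le.trans ?_
      rw [pow_succ']
      exact Nat.mul_le_mul_left _ ih

theorem natDegree_poly_le (a : Fq[X]) :
    (poly Fq a).natDegree ≤ Fintype.card Fq ^ a.natDegree := by
  rw [poly, sum_over_range _ (by simp)]
  refine natDegree_sum_le_of_forall_le _ _ fun i hi => ?_
  exact (natDegree_C_mul_le _ _).trans ((natDegree_powPoly_le i).trans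
    (Nat.pow_le_pow_right Fintype.card_pos (Nat.lt_succ_iff.mp (Finset.mem_range.mp hi))))

theorem poly_ne_zero {a : Fq[X]} (ha : a ≠ 0) : poly Fq a ≠ 0 := by
  intro h
  have := derivative_poly a
  rw [h, derivative_zero, eq_comm, C_eq_zero] at this
  exact ha ((map_eq_zero_iff _ (IsFractionRing.injective Fq[X] (RatFunc Fq))).mp this)

theorem algEquiv_carlitz (σ : Gal(Kbar Fq/RatFunc Fq)) (a : Fq[X]) (u : Kbar Fq) :
    σ (carlitz Fq a u) = carlitz Fq a (σ u) := by
  rw [← aeval_poly, ← aeval_poly, aeval_algHom_apply]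

theorem isSeparable_of_carlitz_mem {a : Fq[X]} (ha : a ≠ 0)
    (M : IntermediateField (RatFunc Fq) (Kbar Fq)) {u : Kbar Fq} (h : carlitz Fq a u ∈ M) :
    IsSeparable M u := by
  set f : M[X] := (poly Fq a).map (algebraMap (RatFunc Fq) M) - C ⟨_, h⟩ with hf
  have hsep : f.Separable := by
    rw [separable_def, hf, derivative_sub, derivative_C, sub_zero, derivative_map, derivative_poly,
      map_C]
    have hunit : IsUnit (C (algebraMap (RatFunc Fq) M (algebraMap Fq[X] (RatFunc Fq) a))) := by
      rw [isUnit_C, isUnit_iff_ne_zero, _root_.map_ne_zero, Ne,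
        map_eq_zero_iff _ (IsFractionRing.injective Fq[X] (RatFunc Fq))]
      exact ha
    obtain ⟨b, hb⟩ := hunit.exists_left_inv
    exact ⟨0, b, by rw [hb, zero_mul, zero_add]⟩
  refine hsep.of_dvd (minpoly.dvd _ _ ?_)
  rw [hf, map_sub, aeval_map_algebraMap, aeval_poly, aeval_C]
  exact sub_self _

theorem Lambda_eq_rootSet {a : Fq[X]} (ha : a ≠ 0) :
    Lambda Fq a = (poly Fq a).rootSet (Kbar Fq) := by
  ext u
  rw [mem_rootSet, aeval_poly]
  exact ⟨fun h => ⟨poly_ne_zero ha, h⟩, fun h => h.2⟩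

theorem finite_Lambda {a : Fq[X]} (ha : a ≠ 0) : (Lambda Fq a).Finite := by
  rw [Lambda_eq_rootSet ha]
  exact rootSet_finite _ _

theorem eq_zero_of_isCoprime {a b : Fq[X]} (h : IsCoprime a b) {u : Kbar Fq}
    (ha : carlitz Fq a u = 0) (hb : carlitz Fq b u = 0) : u = 0 := by
  obtain ⟨x, y, hxy⟩ := h
  rw [← carlitz_one u, ← hxy, carlitz_add_left, carlitz_mul, carlitz_mul, ha, hb, carlitz_zero,
    carlitz_zero, add_zero]

theorem carlitz_eq_zero_iff_dvd {d : Fq[X]} (hd : Irreducible d) {u : Kbar Fq} (hu : u ≠ 0)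
    (hdu : carlitz Fq d u = 0) (m : Fq[X]) : carlitz Fq m u = 0 ↔ d ∣ m := by
  constructor
  · intro hm
    by_contra hdvd
    exact hu (eq_zero_of_isCoprime (hd.coprime_iff_not_dvd.mpr hdvd) hdu hm)
  · rintro ⟨c, rfl⟩
    rw [mul_comm, carlitz_mul, hdu, carlitz_zero]

/-- A generator of `Λ_d` generates it as an `Fq[T]`-module. -/
theorem exists_carlitz_eq {d : Fq[X]} (hd : d ≠ 0) {lam : Kbar Fq}
    (hlam : ∀ m : Fq[X], carlitz Fq m lam = 0 ↔ d ∣ m) {u : Kbar Fq} (hu : u ∈ Lambda Fq d) :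
    ∃ m : Fq[X], u = carlitz Fq m lam := by
  have hdl : carlitz Fq d lam = 0 := (hlam d).mpr dvd_rfl
  have : Finite (Lambda Fq d) := finite_Lambda hd
  let f : degreeLT Fq d.natDegree → Lambda Fq d := fun m =>
    ⟨carlitz Fq m lam, show carlitz Fq d _ = 0 by rw [carlitz_comm, hdl, carlitz_zero]⟩
  have hf : Function.Injective f := by
    intro m n hmn
    have h0 : carlitz Fq (m - n : Fq[X]) lam = 0 := by
      rw [carlitz_sub_left, sub_eq_zero]
      exact congrArg Subtype.val hmn
    rw [hlam] at h0
    have hdeg : (m - n : Fq[X]).degree < d.degree := by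
      have := mem_degreeLT.mp (m - n).2
      rwa [← degree_eq_natDegree hd] at this
    exact Subtype.ext (sub_eq_zero.mp (eq_zero_of_dvd_of_degree_lt h0 hdeg))
  have hcard : Nat.card (Lambda Fq d) ≤ Nat.card (degreeLT Fq d.natDegree) := by
    rw [Nat.card_congr (degreeLTEquiv Fq d.natDegree).toEquiv, Nat.card_fun,
      Nat.card_eq_fintype_card (α := Fq), Nat.card_fin, Lambda_eq_rootSet hd, Nat.card_coe_set_eq]
    exact (ncard_rootSet_le _ _).trans (natDegree_poly_le d)
  have : Finite (degreeLT Fq d.natDegree) :=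
    Finite.of_equiv _ (degreeLTEquiv Fq d.natDegree).symm.toEquiv
  obtain ⟨m, hm⟩ := (hf.bijective_of_nat_card_le hcard).2 ⟨u, hu⟩
  exact ⟨m, (congrArg Subtype.val hm).symm⟩

end Carlitz

namespace Carlitz

variable {Fq}

theorem algEquiv_mem_Lambda (σ : Gal(Kbar Fq/RatFunc Fq)) {d : Fq[X]} {u : Kbar Fq}
    (hu : u ∈ Lambda Fq d) : σ u ∈ Lambda Fq d := by
  change carlitz Fq d (σ u) = 0
  rw [← algEquiv_carlitz, show carlitz Fq d u = 0 from hu, map_zero]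

theorem algEquiv_sub_mem_Lambda {d : Fq[X]} {E : IntermediateField (RatFunc Fq) (Kbar Fq)}
    {α : Kbar Fq} (hα : carlitz Fq d α ∈ E) {σ : Gal(Kbar Fq/RatFunc Fq)}
    (hσ : σ ∈ E.fixingSubgroup) : σ α - α ∈ Lambda Fq d := by
  change carlitz Fq d (σ α - α) = 0
  rw [carlitz_sub, ← algEquiv_carlitz, (mem_fixingSubgroup_iff _ _).mp hσ _ hα, sub_self]

theorem generator_mem_Lambda {d : Fq[X]} {lam : Kbar Fq}
    (hlam : ∀ m : Fq[X], carlitz Fq m lam = 0 ↔ d ∣ m) : lam ∈ Lambda Fq d :=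
  (hlam d).mpr dvd_rfl

section Generator

variable {d : Fq[X]} (hd : Irreducible d) {lam : Kbar Fq}
  (hlam : ∀ m : Fq[X], carlitz Fq m lam = 0 ↔ d ∣ m)
include hd hlam

theorem algEquiv_comm_of_mem_Lambda (σ τ : Gal(Kbar Fq/RatFunc Fq)) {u : Kbar Fq}
    (hu : u ∈ Lambda Fq d) : σ (τ u) = τ (σ u) := by
  have hl := generator_mem_Lambda hlam
  obtain ⟨m, rfl⟩ := exists_carlitz_eq hd.ne_zero hlam hu
  obtain ⟨b, hb⟩ := exists_carlitz_eq hd.ne_zero hlam (algEquiv_mem_Lambda σ hl)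
  obtain ⟨c, hc⟩ := exists_carlitz_eq hd.ne_zero hlam (algEquiv_mem_Lambda τ hl)
  simp only [algEquiv_carlitz, hb, hc]
  rw [carlitz_comm b c]

theorem algEquiv_eq_self_of_mem_Lambda {σ : Gal(Kbar Fq/RatFunc Fq)} (hσ : σ lam = lam)
    {u : Kbar Fq} (hu : u ∈ Lambda Fq d) : σ u = u := by
  obtain ⟨m, rfl⟩ := exists_carlitz_eq hd.ne_zero hlam hu
  rw [algEquiv_carlitz, hσ]

/-- An automorphism moving a generator of `Λ_d` acts on `Λ_d` without nonzero fixed points. -/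
theorem eq_zero_of_algEquiv_eq_self {σ : Gal(Kbar Fq/RatFunc Fq)} (hσ : σ lam ≠ lam)
    {u : Kbar Fq} (hu : u ∈ Lambda Fq d) (h : σ u = u) : u = 0 := by
  by_contra hu0
  refine hσ ?_
  exact algEquiv_eq_self_of_mem_Lambda hd (carlitz_eq_zero_iff_dvd hd hu0 hu) h
    (generator_mem_Lambda hlam)

variable {E : IntermediateField (RatFunc Fq) (Kbar Fq)} {α : Kbar Fq} (hα : carlitz Fq d α ∈ E)
include hα

theorem algEquiv_displacement_eq_self :
    ∀ σ ∈ (adjoin (RatFunc Fq) ((E : Set (Kbar Fq)) ∪ {lam})).fixingSubgroup,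
    ∀ τ ∈ (adjoin (RatFunc Fq) ((E : Set (Kbar Fq)) ∪ {lam})).fixingSubgroup,
      σ (τ α - α) = τ α - α := by
  intro σ hσ τ hτ
  rw [mem_fixingSubgroup_adjoin_union_singleton] at hσ hτ
  exact algEquiv_eq_self_of_mem_Lambda hd hlam hσ.2 (algEquiv_sub_mem_Lambda hα hτ.1)

theorem displacement_subset_Lambda :
    (displacement _ α (algEquiv_displacement_eq_self hd hlam hα) : Set (Kbar Fq)) ⊆
      Lambda Fq d := by
  rintro _ ⟨σ, hσ, rfl⟩
  exact algEquiv_sub_mem_Lambda hα (mem_fixingSubgroup_adjoin_union_singleton.mp hσ).1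

/-- If some automorphism fixes `E(α)` but moves a generator `lam` of `Λ_d`, then all the conjugates
of `α` over `E` are conjugates over `E(lam)`. -/
theorem exists_algEquiv_eq_of_moves_generator {σ : Gal(Kbar Fq/RatFunc Fq)}
    (hσE : σ ∈ E.fixingSubgroup) (hσα : σ α = α) (hσ : σ lam ≠ lam)
    {τ : Gal(Kbar Fq/RatFunc Fq)} (hτ : τ ∈ E.fixingSubgroup) :
    ∃ h ∈ (adjoin (RatFunc Fq) ((E : Set (Kbar Fq)) ∪ {lam})).fixingSubgroup, h α = τ α := by
  set V := displacement _ α (algEquiv_displacement_eq_self hd hlam hα) with hV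
  have hVΛ : (V : Set (Kbar Fq)) ⊆ Lambda Fq d := displacement_subset_Lambda hd hlam hα
  have : Finite V := (finite_Lambda hd.ne_zero).subset hVΛ
  have hl := generator_mem_Lambda hlam
  have hσV : ∀ v ∈ V, σ v ∈ V := by
    rintro _ ⟨h, hh, rfl⟩
    rw [mem_fixingSubgroup_adjoin_union_singleton] at hh
    refine ⟨σ * h * σ⁻¹, ?_, ?_⟩
    · rw [mem_fixingSubgroup_adjoin_union_singleton]
      refine ⟨mul_mem (mul_mem hσE hh.1) (inv_mem hσE), ?_⟩
      rw [AlgEquiv.mul_apply, AlgEquiv.mul_apply, algEquiv_eq_self_of_mem_Lambda hd hlam hh.2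
        (algEquiv_mem_Lambda _ hl), ← AlgEquiv.mul_apply, mul_inv_cancel, AlgEquiv.one_apply]
    · have hinv : σ⁻¹ α = α := by
        conv_lhs => rw [← hσα, ← AlgEquiv.mul_apply, inv_mul_cancel, AlgEquiv.one_apply]
      rw [AlgEquiv.mul_apply, AlgEquiv.mul_apply, hinv, map_sub, hσα]
  let f : V → V := fun v => ⟨σ v - v, sub_mem (hσV v v.2) v.2⟩
  have hinj : ∀ {u v : Kbar Fq}, u ∈ Lambda Fq d → v ∈ Lambda Fq d → σ u - u = σ v - v → u = v := by
    intro u v hu hv huv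
    refine sub_eq_zero.mp (eq_zero_of_algEquiv_eq_self hd hlam hσ (u := u - v) ?_ ?_)
    · change carlitz Fq d (u - v) = 0
      rw [carlitz_sub, show carlitz Fq d u = 0 from hu, show carlitz Fq d v = 0 from hv, sub_zero]
    · rw [map_sub]
      linear_combination huv
  have hf : Function.Injective f := fun u v huv =>
    Subtype.ext (hinj (hVΛ u.2) (hVΛ v.2) (congrArg Subtype.val huv))
  have hs := algEquiv_sub_mem_Lambda hα hτ
  have hmem : σ (τ α - α) - (τ α - α) ∈ V := by
    have hcomm : ∀ u ∈ Lambda Fq d, (σ * τ * (τ * σ)⁻¹) u = u := by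
      intro u hu
      rw [AlgEquiv.mul_apply, AlgEquiv.mul_apply,
        algEquiv_comm_of_mem_Lambda hd hlam σ τ (algEquiv_mem_Lambda _ hu), ← AlgEquiv.mul_apply,
        ← AlgEquiv.mul_apply, mul_inv_cancel, AlgEquiv.one_apply]
    refine ⟨σ * τ * (τ * σ)⁻¹, ?_, ?_⟩
    · rw [mem_fixingSubgroup_adjoin_union_singleton]
      exact ⟨mul_mem (mul_mem hσE hτ) (inv_mem (mul_mem hτ hσE)), hcomm lam hl⟩
    · have h1 : (σ * τ * (τ * σ)⁻¹) (τ α) = σ (τ α) := by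
        conv_lhs => rw [← hσα, ← AlgEquiv.mul_apply τ σ, ← AlgEquiv.mul_apply, inv_mul_cancel_right,
          AlgEquiv.mul_apply]
      have h2 := hcomm _ hs
      rw [map_sub, h1] at h2
      rw [map_sub, hσα]
      linear_combination -h2
  obtain ⟨⟨v, hv⟩, hfv⟩ := (Finite.injective_iff_surjective.mp hf) ⟨_, hmem⟩
  have hvs := hinj (hVΛ hv) hs (congrArg Subtype.val hfv)
  obtain ⟨h, hh, hhv⟩ := hvs ▸ hv
  exact ⟨h, hh, sub_left_inj.mp hhv⟩

end Generator

theorem exists_algEquiv_eq_of_pure {d : Fq[X]} (hd : Irreducible d)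
    {E L : IntermediateField (RatFunc Fq) (Kbar Fq)} {α : Kbar Fq}
    (hpure : IsPureC Fq E L) (hL : L = adjoin (RatFunc Fq) ((E : Set (Kbar Fq)) ∪ {α}))
    (hα : carlitz Fq d α ∈ E) {lam : Kbar Fq}
    (hlam : ∀ m : Fq[X], carlitz Fq m lam = 0 ↔ d ∣ m) {τ : Gal(Kbar Fq/RatFunc Fq)}
    (hτ : τ ∈ E.fixingSubgroup) :
    ∃ h ∈ (adjoin (RatFunc Fq) ((E : Set (Kbar Fq)) ∪ {lam})).fixingSubgroup, h α = τ α := by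
  have hl : carlitz Fq d lam = 0 := generator_mem_Lambda hlam
  by_cases hlE : lam ∈ E
  · exact ⟨τ, mem_fixingSubgroup_adjoin_union_singleton.mpr
      ⟨hτ, (mem_fixingSubgroup_iff _ _).mp hτ _ hlE⟩, rfl⟩
  · have hlL : lam ∉ L := fun h => hlE (hpure d hd lam h hl)
    have hsep : IsSeparable L lam :=
      isSeparable_of_carlitz_mem hd.ne_zero L (hl.symm ▸ zero_mem L)
    obtain ⟨σ, hσ, hne⟩ : ∃ σ ∈ L.fixingSubgroup, σ lam ≠ lam := by
      by_contra! h
      exact hlL (L.mem_of_forall_mem_fixingSubgroup hsep h)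
    rw [hL, mem_fixingSubgroup_adjoin_union_singleton] at hσ
    exact exists_algEquiv_eq_of_moves_generator hd hlam hα hσ.1 hσ.2 hne hτ

end Carlitz

/-- Let `k ⊆ E ⊆ L ⊆ k̄` with `L/E` pure, `L = E(α)`, and suppose
there is an irreducible `d ∈ Fq[T]` with `C_d(α) ∈ E`.  Then `L/E` is cyclotomic
coradical and `[L : E] = p^s` for some `s ∈ ℕ`.  Moreover, for any generator `λ_d` of
`Λ_d` (i.e. any element whose annihilator is exactly `(d)`): `E(α) ∩ E(λ_d) = E`,
`[L : E] = [L(λ_d) : E(λ_d)]`, and the minimal polynomial of `α` over `E` equals the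
minimal polynomial of `α` over `E(λ_d)`. -/
theorem simple_pure_radical (p : ℕ) [Fact p.Prime] [CharP Fq p]
    (E L : IntermediateField (RatFunc Fq) (Kbar Fq)) (hEL : E ≤ L)
    (hpure : IsPureC Fq E L) (α : Kbar Fq)
    (hLα : L = adjoin (RatFunc Fq) ((E : Set (Kbar Fq)) ∪ {α}))
    (d : Polynomial Fq) (hd : Irreducible d) (hdα : carlitz Fq d α ∈ E) :
    IsCycloCoradicalC Fq E L ∧
    (∃ s : ℕ, Module.finrank E (extendScalars hEL) = p ^ s) ∧
    ∀ lam : Kbar Fq, (∀ m : Polynomial Fq, carlitz Fq m lam = 0 ↔ d ∣ m) →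
      (L ⊓ adjoin (RatFunc Fq) ((E : Set (Kbar Fq)) ∪ {lam}) = E) ∧
      (∀ hsub : adjoin (RatFunc Fq) ((E : Set (Kbar Fq)) ∪ {lam}) ≤
          adjoin (RatFunc Fq) ((L : Set (Kbar Fq)) ∪ {lam}),
        Module.finrank E (extendScalars hEL) =
          Module.finrank (adjoin (RatFunc Fq) ((E : Set (Kbar Fq)) ∪ {lam}))
            (extendScalars hsub)) ∧
      (∀ hE : E ≤ adjoin (RatFunc Fq) ((E : Set (Kbar Fq)) ∪ {lam}),
        (minpoly E α).map (IntermediateField.inclusion hE).toRingHom =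
          minpoly (adjoin (RatFunc Fq) ((E : Set (Kbar Fq)) ∪ {lam})) α) := by
  have hαE : IsSeparable E α := Carlitz.isSeparable_of_carlitz_mem hd.ne_zero E hdα
  have hαL : α ∈ L := hLα ▸ subset_adjoin _ _ (Or.inr rfl)
  have hsepL : IsSeparableC Fq E L := fun u hu => isSeparable_of_mem_adjoin hEL hLα hαE hu
  refine ⟨⟨⟨{α}, ?_, hLα⟩, hsepL, hpure⟩, ?_, ?_⟩
  · rintro _ rfl
    exact ⟨hαL, d, hd.ne_zero, hdα⟩
  · rw [finrank_extendScalars_eq_natDegree hEL hLα hαE.isIntegral]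
    by_cases hα : α ∈ E
    · refine ⟨0, ?_⟩
      rw [pow_zero, minpoly.natDegree_eq_one_iff]
      exact ⟨⟨α, hα⟩, rfl⟩
    · obtain ⟨σ, hσ, hne⟩ : ∃ σ ∈ E.fixingSubgroup, σ α ≠ α := by
        by_contra! h
        exact hα (E.mem_of_forall_mem_fixingSubgroup hαE h)
      have hlam := Carlitz.carlitz_eq_zero_iff_dvd hd (sub_ne_zero.mpr hne)
        (Carlitz.algEquiv_sub_mem_Lambda hdα hσ)
      have hEF : E ≤ adjoin (RatFunc Fq) ((E : Set (Kbar Fq)) ∪ {σ α - α}) :=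
        fun z hz => subset_adjoin _ _ (Or.inl hz)
      have hαF := Carlitz.isSeparable_of_carlitz_mem hd.ne_zero _ (hEF hdα)
      have hmin := minpoly_map_inclusion_eq hEF hαE hαF fun τ hτ =>
        Carlitz.exists_algEquiv_eq_of_pure hd hpure hLα hdα hlam hτ
      have hchar : CharP (Kbar Fq) p :=
        charP_of_injective_algebraMap (algebraMap Fq (Kbar Fq)).injective p
      rw [← natDegree_map (inclusion hEF).toRingHom, hmin, natDegree_minpoly_eq_card_orbit _ hαF,
        card_orbit_eq_card_displacement (Carlitz.algEquiv_displacement_eq_self hd hlam hdα)]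
      exact AddSubgroup.exists_card_eq_prime_pow p _ ((Carlitz.finite_Lambda hd.ne_zero).subset
        (Carlitz.displacement_subset_Lambda hd hlam hdα))
  · intro lam hlam
    have hconj : ∀ τ ∈ E.fixingSubgroup,
        ∃ h ∈ (adjoin (RatFunc Fq) ((E : Set (Kbar Fq)) ∪ {lam})).fixingSubgroup, h α = τ α :=
      fun τ hτ => Carlitz.exists_algEquiv_eq_of_pure hd hpure hLα hdα hlam hτ
    have hEF : E ≤ adjoin (RatFunc Fq) ((E : Set (Kbar Fq)) ∪ {lam}) :=
      fun z hz => subset_adjoin _ _ (Or.inl hz)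
    have hαF := Carlitz.isSeparable_of_carlitz_mem hd.ne_zero _ (hEF hdα)
    have hmin := minpoly_map_inclusion_eq hEF hαE hαF hconj
    refine ⟨le_antisymm ?_ (le_inf hEL hEF), fun hsub => ?_, fun _ => hmin⟩
    · rintro x ⟨hxL, hxF⟩
      refine E.mem_of_forall_mem_fixingSubgroup (hsepL x hxL) fun τ hτ => ?_
      obtain ⟨h, hh, hhτ⟩ := hconj τ hτ
      have hfix : h⁻¹ * τ ∈ L.fixingSubgroup := by
        rw [hLα, mem_fixingSubgroup_adjoin_union_singleton]
        refine ⟨mul_mem (inv_mem (fixingSubgroup_le hEF hh)) hτ, ?_⟩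
        rw [AlgEquiv.mul_apply, ← hhτ, ← AlgEquiv.mul_apply, inv_mul_cancel, AlgEquiv.one_apply]
      have hx : h ((h⁻¹ * τ) x) = h x := congrArg h ((mem_fixingSubgroup_iff _ _).mp hfix x hxL)
      rwa [← AlgEquiv.mul_apply, mul_inv_cancel_left,
        (mem_fixingSubgroup_iff _ _).mp hh x hxF] at hx
    · have hadj : adjoin (RatFunc Fq) ((L : Set (Kbar Fq)) ∪ {lam}) = adjoin (RatFunc Fq)
          ((adjoin (RatFunc Fq) ((E : Set (Kbar Fq)) ∪ {lam}) : Set (Kbar Fq)) ∪ {α}) := by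
        refine le_antisymm (adjoin_le_iff.mpr (Set.union_subset ?_ ?_))
          (adjoin_le_iff.mpr (Set.union_subset hsub ?_))
        · refine SetLike.coe_subset_coe.mpr (hLα.le.trans (adjoin.mono _ _ _ ?_))
          exact Set.union_subset_union_left _ hEF
        · rintro _ rfl
          exact subset_adjoin _ _ (Or.inl (subset_adjoin _ _ (Or.inr rfl)))
        · rintro _ rfl
          exact subset_adjoin _ _ (Or.inl hαL)
      rw [finrank_extendScalars_eq_natDegree hEL hLα hαE.isIntegral,
        finrank_extendScalars_eq_natDegree hsub hadj hαF.isIntegral, ← hmin, natDegree_map]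

end
end
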